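/- arXiv:2001.00490 — 2 statements merged into one kernel-verified Lean document; each statement's English description precedes it below -/
import Mathlib

section
/- Let ψ_T be the kernel with Fourier transform C·exp(−T(k₁⁴ + k₂²)) normalized so that ‖ψ₁‖_{L¹(ℝ²)} = 1. For every α ≥ 0 and integers i, j ≥ 0 there is a constant C(α, i, j) such that for all T > 0 and all y ∈ ℝ², ∫_{ℝ²} d(x, y)^α · |∂₁^i ∂₂^j ψ_T(x − y)| dx ≤ C(α, i, j) · T^{(α − i − 2j)/4}, where d is the parabolic distance. -/
open MeasureTheory

/-- The parabolic distance on `ℝ²`. -/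
noncomputable def pdist (x y : ℝ × ℝ) : ℝ := |x.1 - y.1| + Real.sqrt |x.2 - y.2|

/-- Partial derivative in the first (space-like) variable. -/
noncomputable def pd1 (f : ℝ × ℝ → ℝ) : ℝ × ℝ → ℝ := fun x => deriv (fun s => f (s, x.2)) x.1

/-- Partial derivative in the second (time-like) variable. -/
noncomputable def pd2 (f : ℝ × ℝ → ℝ) : ℝ × ℝ → ℝ := fun x => deriv (fun s => f (x.1, s)) x.2

def IsPsiKernel (ψ : ℝ → ℝ × ℝ → ℝ) : Prop :=
  (∀ T : ℝ, 0 < T → ∃ φ : SchwartzMap (ℝ × ℝ) ℝ, ψ T = ⇑φ) ∧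
  (∃ C : ℝ, ∀ T : ℝ, 0 < T → ∀ k : ℝ × ℝ,
      (∫ x : ℝ × ℝ,
          Complex.exp (-(2 * Real.pi * (k.1 * x.1 + k.2 * x.2) : ℝ) * Complex.I) * (ψ T x : ℂ))
        = (C : ℂ) * Complex.exp ((-(T * (k.1 ^ 4 + k.2 ^ 2)) : ℝ) : ℂ)) ∧
  (∫ x : ℝ × ℝ, |ψ 1 x|) = 1

open scoped FourierTransform

/-- The anisotropic dilation `(x₁, x₂) ↦ (a x₁, b x₂)` scales Lebesgue measure by `(ab)⁻¹`. -/
lemma map_dilation_volume {a b : ℝ} (ha : 0 < a) (hb : 0 < b) :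
    Measure.map (Prod.map (fun x => a * x) (fun x => b * x)) (volume : Measure (ℝ × ℝ)) =
      ENNReal.ofReal (a * b)⁻¹ • volume := by
  rw [Measure.volume_eq_prod,
    ← Measure.map_prod_map _ _ (measurable_const_mul a) (measurable_const_mul b),
    Real.map_volume_mul_left ha.ne', Real.map_volume_mul_left hb.ne',
    Measure.prod_smul_left, Measure.prod_smul_right, smul_smul,
    ← ENNReal.ofReal_mul (abs_nonneg _), abs_of_pos (inv_pos.2 ha), abs_of_pos (inv_pos.2 hb),
    mul_inv]

lemma measurableEmbedding_dilation {a b : ℝ} (ha : 0 < a) (hb : 0 < b) :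
    MeasurableEmbedding (Prod.map (fun x => a * x) (fun x => b * x) : ℝ × ℝ → ℝ × ℝ) :=
  (measurableEmbedding_mulLeft₀ ha.ne').prodMap (measurableEmbedding_mulLeft₀ hb.ne')

lemma integral_comp_dilation {E : Type*} [NormedAddCommGroup E] [NormedSpace ℝ E]
    {a b : ℝ} (ha : 0 < a) (hb : 0 < b) (F : ℝ × ℝ → E) :
    ∫ x : ℝ × ℝ, F (a * x.1, b * x.2) = (a * b)⁻¹ • ∫ x : ℝ × ℝ, F x := by
  have h := (measurableEmbedding_dilation ha hb).integral_map (μ := volume) F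
  rw [map_dilation_volume ha hb, integral_smul_measure,
    ENNReal.toReal_ofReal (by positivity)] at h
  exact h.symm

lemma integrable_comp_dilation {E : Type*} [NormedAddCommGroup E]
    {a b : ℝ} (ha : 0 < a) (hb : 0 < b) {F : ℝ × ℝ → E} (hF : Integrable F) :
    Integrable fun x : ℝ × ℝ => F (a * x.1, b * x.2) := by
  refine ((measurableEmbedding_dilation ha hb).integrable_map_iff (μ := volume)).1 ?_
  rw [map_dilation_volume ha hb]
  exact hF.smul_measure ENNReal.ofReal_ne_top

/-- A continuous integrable function on the plane with vanishing Fourier transform is zero. -/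
lemma eq_zero_of_fourier_eq_zero {f : ℝ × ℝ → ℂ} (hc : Continuous f) (hf : Integrable f)
    (h : ∀ k : ℝ × ℝ, (∫ x : ℝ × ℝ,
      Complex.exp (-(2 * Real.pi * (k.1 * x.1 + k.2 * x.2) : ℝ) * Complex.I) * f x) = 0) :
    f = 0 := by
  have hmp := Complex.volume_preserving_equiv_real_prod
  let g : ℂ → ℂ := fun z => f (Complex.measurableEquivRealProd z)
  have hgc : Continuous g := hc.comp Complex.equivRealProdCLM.continuous
  have hgi : Integrable g :=
    (hmp.integrable_comp_emb Complex.measurableEquivRealProd.measurableEmbedding).2 hf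
  have hF : 𝓕 g = 0 := by
    funext w
    rw [Real.fourier_eq']
    simp only [Pi.zero_apply]
    rw [← h (w.re, w.im),
      ← hmp.integral_comp Complex.measurableEquivRealProd.measurableEmbedding]
    refine integral_congr_ae (Filter.Eventually.of_forall fun z => ?_)
    simp only [g, smul_eq_mul, Complex.measurableEquivRealProd_apply, Complex.inner]
    congr 2
    simp
  have hinv := hgc.fourierInv_fourier_eq hgi (by rw [hF]; exact integrable_zero _ _ _)
  rw [hF] at hinv
  have hg : g = 0 := by
    rw [← hinv]
    funext w
    simp [Real.fourierInv_eq']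
  funext x
  simpa [g] using congrFun hg (Complex.measurableEquivRealProd.symm x)

lemma pd1_iterate_dilation (a b c : ℝ) (f : ℝ × ℝ → ℝ) (i : ℕ) :
    pd1^[i] (fun x => c * f (a * x.1, b * x.2)) =
      fun x => c * a ^ i * (pd1^[i] f) (a * x.1, b * x.2) := by
  induction i with
  | zero => simp
  | succ i ih =>
    rw [Function.iterate_succ_apply', ih]
    funext x
    simp only [pd1, Function.iterate_succ_apply', deriv_const_mul_field]
    rw [deriv_comp_mul_left a (fun s => (pd1^[i] f) (s, b * x.2)), smul_eq_mul]
    ring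

lemma pd2_iterate_dilation (a b c : ℝ) (f : ℝ × ℝ → ℝ) (j : ℕ) :
    pd2^[j] (fun x => c * f (a * x.1, b * x.2)) =
      fun x => c * b ^ j * (pd2^[j] f) (a * x.1, b * x.2) := by
  induction j with
  | zero => simp
  | succ j ih =>
    rw [Function.iterate_succ_apply', ih]
    funext x
    simp only [pd2, Function.iterate_succ_apply', deriv_const_mul_field]
    rw [deriv_comp_mul_left b (fun s => (pd2^[j] f) (a * x.1, s)), smul_eq_mul]
    ring

/-- The kernels at different scales are parabolic dilations of each other. -/
lemma IsPsiKernel.eq_dilation {ψ : ℝ → ℝ × ℝ → ℝ} (hψ : IsPsiKernel ψ) {a : ℝ} (ha : 0 < a) :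
    ψ (a ^ 4)⁻¹ = fun x => a ^ 3 * ψ 1 (a * x.1, a ^ 2 * x.2) := by
  obtain ⟨hS, ⟨C, hC⟩, -⟩ := hψ
  have hT : 0 < (a ^ 4)⁻¹ := by positivity
  have hreg : ∀ T : ℝ, 0 < T → Continuous (ψ T) ∧ Integrable (ψ T) := by
    intro T hT
    obtain ⟨φ, hφ⟩ := hS T hT
    rw [hφ]
    exact ⟨φ.continuous, φ.integrable⟩
  obtain ⟨hc, hi⟩ := hreg _ hT
  obtain ⟨hc1, hi1⟩ := hreg 1 one_pos
  have hdc : Continuous fun x : ℝ × ℝ => a ^ 3 * ψ 1 (a * x.1, a ^ 2 * x.2) := by fun_prop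
  have hdi : Integrable fun x : ℝ × ℝ => a ^ 3 * ψ 1 (a * x.1, a ^ 2 * x.2) := by
    exact (integrable_comp_dilation ha (pow_pos ha 2) hi1).const_mul _
  have hint : ∀ (k : ℝ × ℝ) {g : ℝ × ℝ → ℝ}, Integrable g → Integrable fun x : ℝ × ℝ =>
      Complex.exp (-(2 * Real.pi * (k.1 * x.1 + k.2 * x.2) : ℝ) * Complex.I) * (g x : ℂ) := by
    intro k g hg
    refine hg.ofReal.bdd_mul (c := 1) (by fun_prop) (Filter.Eventually.of_forall fun x => ?_)
    rw [← Complex.ofReal_neg, Complex.norm_exp_ofReal_mul_I]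
  have hzero := eq_zero_of_fourier_eq_zero
    (f := fun x => (ψ (a ^ 4)⁻¹ x : ℂ) - ((a ^ 3 * ψ 1 (a * x.1, a ^ 2 * x.2) : ℝ) : ℂ))
    (by fun_prop) (hi.ofReal.sub hdi.ofReal) (fun k => by
      simp only [mul_sub]
      rw [integral_sub (hint k hi) (hint k hdi), hC _ hT k, sub_eq_zero]
      have h1 := hC 1 one_pos (k.1 / a, k.2 / a ^ 2)
      have h2 := integral_comp_dilation ha (pow_pos ha 2) (fun x : ℝ × ℝ =>
        Complex.exp (-(2 * Real.pi * (k.1 / a * x.1 + k.2 / a ^ 2 * x.2) : ℝ)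
          * Complex.I) * (ψ 1 x : ℂ))
      rw [h1] at h2
      have hexp : 1 * ((k.1 / a) ^ 4 + (k.2 / a ^ 2) ^ 2) =
          (a ^ 4)⁻¹ * (k.1 ^ 4 + k.2 ^ 2) := by field_simp
      rw [hexp] at h2
      have ha' : (a : ℂ) ≠ 0 := by exact_mod_cast ha.ne'
      calc _ = _ := ?_
        _ = _ := congrArg (fun z => (a ^ 3 : ℂ) * z) h2.symm
        _ = _ := ?_
      · rw [Complex.real_smul]
        push_cast
        field_simp
      · simp only
        rw [← integral_const_mul]
        refine integral_congr_ae (Filter.Eventually.of_forall fun x => ?_)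
        have hk : k.1 / a * (a * x.1) + k.2 / a ^ 2 * (a ^ 2 * x.2) =
          k.1 * x.1 + k.2 * x.2 := by field_simp
        simp only [hk]
        push_cast
        ring)
  funext x
  have := congrFun hzero x
  simp only [Pi.zero_apply, sub_eq_zero] at this
  exact_mod_cast this

/-- The parabolic distance is homogeneous under the parabolic dilations. -/
lemma pdist_dilation_zero {a : ℝ} (ha : 0 < a) (x : ℝ × ℝ) :
    pdist (a * x.1, a ^ 2 * x.2) 0 = a * pdist x 0 := by
  simp only [pdist, Prod.fst_zero, Prod.snd_zero, sub_zero, abs_mul, abs_pow, abs_of_pos ha]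
  rw [Real.sqrt_mul (by positivity), Real.sqrt_sq ha.le]
  ring

lemma pdist_nonneg (x y : ℝ × ℝ) : 0 ≤ pdist x y :=
  add_nonneg (abs_nonneg _) (Real.sqrt_nonneg _)

/-- moment bounds for the derivatives of the kernel `ψ_T`. -/
theorem psi_moment_bound
    (ψ : ℝ → ℝ × ℝ → ℝ) (hψ : IsPsiKernel ψ)
    (α : ℝ) (hα : 0 ≤ α) (i j : ℕ) :
    ∃ C : ℝ, ∀ T : ℝ, 0 < T → ∀ y : ℝ × ℝ,
      (∫ x : ℝ × ℝ, pdist x y ^ α * |(pd1^[i] (pd2^[j] (ψ T))) (x - y)|)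
        ≤ C * T ^ ((α - (i : ℝ) - 2 * (j : ℝ)) / 4) := by
  refine ⟨∫ x : ℝ × ℝ, pdist x 0 ^ α * |(pd1^[i] (pd2^[j] (ψ 1))) x|, fun T hT y => le_of_eq ?_⟩
  obtain ⟨a, ha, rfl⟩ : ∃ a : ℝ, 0 < a ∧ (a ^ 4)⁻¹ = T := by
    refine ⟨T ^ (-(1 / 4) : ℝ), by positivity, ?_⟩
    rw [← Real.rpow_natCast, ← Real.rpow_mul hT.le, ← Real.rpow_neg hT.le]
    norm_num
  have hpow : ((a ^ 4)⁻¹ : ℝ) ^ ((α - (i : ℝ) - 2 * (j : ℝ)) / 4) =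
      (a ^ α)⁻¹ * a ^ i * (a ^ 2) ^ j := by
    rw [← Real.rpow_natCast a 4, ← Real.rpow_neg ha.le, ← Real.rpow_mul ha.le,
      ← Real.rpow_neg ha.le, ← pow_mul, ← Real.rpow_natCast a i, ← Real.rpow_natCast a (2 * j),
      ← Real.rpow_add ha, ← Real.rpow_add ha]
    congr 1
    push_cast
    ring
  have htrans := integral_sub_right_eq_self (μ := (volume : Measure (ℝ × ℝ)))
    (fun x => pdist x 0 ^ α * |(pd1^[i] (pd2^[j] (ψ (a ^ 4)⁻¹))) x|) y
  have hscale := integral_comp_dilation ha (pow_pos ha 2)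
    (fun x => pdist x 0 ^ α * |(pd1^[i] (pd2^[j] (ψ 1))) x|)
  have hpd : ∀ x : ℝ × ℝ, pdist (x - y) 0 = pdist x y := fun x => by simp [pdist]
  simp only [hpd] at htrans
  rw [htrans, hψ.eq_dilation ha, pd2_iterate_dilation, pd1_iterate_dilation, hpow]
  have hint : ∀ x : ℝ × ℝ, pdist x 0 ^ α *
      |a ^ 3 * (a ^ 2) ^ j * a ^ i * (pd1^[i] (pd2^[j] (ψ 1))) (a * x.1, a ^ 2 * x.2)| =
      (a ^ 3 * (a ^ 2) ^ j * a ^ i * (a ^ α)⁻¹) * (pdist (a * x.1, a ^ 2 * x.2) 0 ^ α *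
        |(pd1^[i] (pd2^[j] (ψ 1))) (a * x.1, a ^ 2 * x.2)|) := by
    intro x
    have : a ^ α ≠ 0 := by positivity
    rw [pdist_dilation_zero ha, Real.mul_rpow ha.le (pdist_nonneg _ _), abs_mul,
      abs_of_pos (by positivity : 0 < a ^ 3 * (a ^ 2) ^ j * a ^ i)]
    field_simp
  simp only [hint]
  rw [integral_const_mul, hscale, smul_eq_mul]
  field_simp
end

section
/- Let ψ_T be the kernel with Fourier transform C·exp(−T(k₁⁴ + k₂²)) normalized so that ‖ψ₁‖_{L¹(ℝ²)} = 1. There is a universal constant C₀ such that for every bounded measurable u : ℝ² → ℝ and all 0 < t ≤ T, ‖u * ψ_T‖_{L^∞(ℝ²)} ≤ C₀ · ‖u * ψ_t‖_{L^∞(ℝ²)} (monotonicity of the L^∞-norm in the convolution scale). -/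
open MeasureTheory

/-- The character `x ↦ exp (-2πi k·x)` of the plane. -/
noncomputable def planeChar (k x : ℝ × ℝ) : ℂ :=
  Complex.exp (-(2 * Real.pi * (k.1 * x.1 + k.2 * x.2) : ℝ) * Complex.I)

lemma continuous_planeChar (k : ℝ × ℝ) : Continuous (planeChar k) := by
  unfold planeChar
  fun_prop

lemma norm_planeChar (k x : ℝ × ℝ) : ‖planeChar k x‖ = 1 := by
  unfold planeChar
  rw [← Complex.ofReal_neg, Complex.norm_exp_ofReal_mul_I]

lemma planeChar_add (k x y : ℝ × ℝ) : planeChar k (x + y) = planeChar k x * planeChar k y := by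
  unfold planeChar
  rw [← Complex.exp_add]
  congr 1
  push_cast [Prod.fst_add, Prod.snd_add]
  ring

lemma MeasureTheory.Integrable.planeChar_mul {f : ℝ × ℝ → ℝ} (hf : Integrable f) (k : ℝ × ℝ) :
    Integrable fun x => planeChar k x * (f x : ℂ) :=
  (hf.ofReal (𝕜 := ℂ)).bdd_mul (c := 1) (continuous_planeChar k).aestronglyMeasurable
    (Filter.Eventually.of_forall fun x => (norm_planeChar k x).le)

/-- An integrable function on the plane with vanishing Fourier transform vanishes almost
everywhere. -/
lemma ae_eq_zero_of_integral_planeChar_eq_zero {h : ℝ × ℝ → ℝ} (hh : Integrable h)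
    (hF : ∀ k, ∫ x, planeChar k x * (h x : ℂ) = 0) : h =ᵐ[volume] 0 := by
  have hm := hh.aestronglyMeasurable.aemeasurable
  have hfin := isFiniteMeasure_withDensity_ofReal hh.2
  have hfin' := isFiniteMeasure_withDensity_ofReal hh.neg.2
  have key : volume.withDensity (fun x => ENNReal.ofReal (h x)) =
      volume.withDensity (fun x => ENNReal.ofReal ((-h) x)) := by
    apply Measure.ext_of_charFunDual
    ext L
    rw [charFunDual_apply, charFunDual_apply,
      integral_withDensity_eq_integral_toReal_smul₀ hm.ennreal_ofReal (by simp),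
      integral_withDensity_eq_integral_toReal_smul₀ hm.neg.ennreal_ofReal (by simp)]
    set k : ℝ × ℝ := (-(L (1, 0)) / (2 * Real.pi), -(L (0, 1)) / (2 * Real.pi)) with hk
    have hL (v : ℝ × ℝ) : Complex.exp (L v * Complex.I) = planeChar k v := by
      have : L v = v.1 * L (1, 0) + v.2 * L (0, 1) := by
        rw [← smul_eq_mul, ← smul_eq_mul, ← map_smul, ← map_smul, ← map_add]
        simp
      unfold planeChar
      rw [this, ← Complex.ofReal_neg]
      congr 3
      simp only [hk]
      field_simp
      ring
    have hi {g : ℝ × ℝ → ℝ} (hg : Integrable g) :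
        Integrable fun x => (ENNReal.ofReal (g x)).toReal • planeChar k x := by
      simp only [ENNReal.toReal_ofReal', Complex.real_smul, mul_comm _ (planeChar k _)]
      exact hg.pos_part.planeChar_mul k
    simp only [hL]
    rw [← sub_eq_zero, ← integral_sub (hi hh) (hi hh.neg), ← hF k]
    congr 1 with x
    rw [← sub_smul]
    simp only [ENNReal.toReal_ofReal', Pi.neg_apply, Complex.real_smul]
    rw [mul_comm, max_zero_sub_max_neg_zero_eq_self]
  rw [withDensity_eq_iff hm.ennreal_ofReal hm.neg.ennreal_ofReal] at key
  · filter_upwards [key] with x hx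
    have := congrArg ENNReal.toReal hx
    simp only [ENNReal.toReal_ofReal', Pi.neg_apply] at this
    have := max_zero_sub_max_neg_zero_eq_self (h x)
    simp only [Pi.zero_apply]
    linarith
  · exact hh.lintegral_lt_top.ne

lemma ae_eq_of_integral_planeChar_eq {f g : ℝ × ℝ → ℝ} (hf : Integrable f) (hg : Integrable g)
    (hF : ∀ k, ∫ x, planeChar k x * (f x : ℂ) = ∫ x, planeChar k x * (g x : ℂ)) :
    f =ᵐ[volume] g := by
  rw [Filter.eventuallyEq_iff_sub]
  refine ae_eq_zero_of_integral_planeChar_eq_zero (hf.sub hg) fun k => ?_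
  rw [← sub_eq_zero.mpr (hF k),
    ← integral_sub (hf.planeChar_mul k) (hg.planeChar_mul k)]
  congr 1 with x
  simp [mul_sub]

lemma integral_planeChar_convolution {f g : ℝ × ℝ → ℝ} (hf : Integrable f) (hg : Integrable g)
    (k : ℝ × ℝ) :
    ∫ x, planeChar k x * ((∫ y, f y * g (x - y) : ℝ) : ℂ) =
      (∫ x, planeChar k x * (f x : ℂ)) * ∫ x, planeChar k x * (g x : ℂ) := by
  have := integral_convolution (ContinuousLinearMap.mul ℝ ℂ)
    (hf.planeChar_mul k) (hg.planeChar_mul k)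
  simp only [ContinuousLinearMap.mul_apply'] at this
  refine Eq.trans ?_ this
  congr 1 with x
  rw [convolution_def, ← integral_complex_ofReal, ← integral_const_mul]
  congr 1 with y
  rw [ContinuousLinearMap.mul_apply']
  have : planeChar k x = planeChar k y * planeChar k (x - y) := by
    rw [← planeChar_add, add_sub_cancel]
  rw [this]
  push_cast
  ring

/-- The linear map `(x₁, x₂) ↦ (a x₁, b x₂)` scales Lebesgue measure by `(|a| |b|)⁻¹`. -/
lemma map_prodMap_mul_volume {a b : ℝ} (ha : a ≠ 0) (hb : b ≠ 0) :
    Measure.map (Prod.map (a * ·) (b * ·)) (volume : Measure (ℝ × ℝ)) =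
      ENNReal.ofReal |a⁻¹ * b⁻¹| • volume := by
  rw [Measure.volume_eq_prod, ← Measure.map_prod_map _ _ (by fun_prop) (by fun_prop),
    Real.map_volume_mul_left ha, Real.map_volume_mul_left hb, Measure.prod_smul_left,
    Measure.prod_smul_right, smul_smul, abs_mul, ENNReal.ofReal_mul (abs_nonneg _)]

lemma integral_comp_prodMap_mul {E : Type*} [NormedAddCommGroup E] [NormedSpace ℝ E]
    {a b : ℝ} (ha : a ≠ 0) (hb : b ≠ 0) {F : ℝ × ℝ → E} (hF : Continuous F) :
    ∫ x : ℝ × ℝ, F (a * x.1, b * x.2) = |a⁻¹ * b⁻¹| • ∫ x, F x := by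
  have h := integral_map (μ := (volume : Measure (ℝ × ℝ))) (φ := Prod.map (a * ·) (b * ·))
    (by fun_prop) (f := F) hF.aestronglyMeasurable
  rw [map_prodMap_mul_volume ha hb, integral_smul_measure,
    ENNReal.toReal_ofReal (abs_nonneg _)] at h
  exact h.symm

lemma integrable_comp_prodMap_mul {a b : ℝ} (ha : a ≠ 0) (hb : b ≠ 0) {F : ℝ × ℝ → ℝ}
    (hF : Integrable F) : Integrable fun x : ℝ × ℝ => F (a * x.1, b * x.2) := by
  have h : Integrable F (Measure.map (Prod.map (a * ·) (b * ·)) (volume : Measure (ℝ × ℝ))) := by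
    rw [map_prodMap_mul_volume ha hb]
    exact hF.smul_measure ENNReal.ofReal_ne_top
  exact h.comp_measurable (by fun_prop)

/-- Convolving a convolution with a third kernel: `(u * f) * g = u * (f * g)` for bounded `u` and
integrable `f`, `g`. -/
lemma integral_convolution_assoc {u f g : ℝ × ℝ → ℝ} (hu : Measurable u) {B : ℝ}
    (hB : ∀ x, |u x| ≤ B) (hf : Integrable f) (hg : Integrable g) (x : ℝ × ℝ) :
    ∫ z, u z * ∫ y, f y * g (x - z - y) = ∫ y, (∫ z, u z * f (y - z)) * g (x - y) := by
  have h₁ : Integrable fun p : (ℝ × ℝ) × (ℝ × ℝ) => g (x - p.2) * f (-(p.1 - p.2)) :=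
    (hg.comp_sub_left x).convolution_integrand (ContinuousLinearMap.mul ℝ ℝ) hf.comp_neg
  have h₂ : Integrable fun p : (ℝ × ℝ) × (ℝ × ℝ) => u p.1 * (f (p.2 - p.1) * g (x - p.2)) := by
    refine Integrable.bdd_mul (c := B) ?_ (hu.comp measurable_fst).aestronglyMeasurable
      (Filter.Eventually.of_forall fun p => hB p.1)
    simpa only [neg_sub, mul_comm] using h₁
  calc ∫ z, u z * ∫ y, f y * g (x - z - y)
      = ∫ z, ∫ y, u z * (f (y - z) * g (x - y)) := by
        congr 1 with z
        rw [integral_const_mul, ← integral_sub_right_eq_self _ z]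
        simp only [sub_sub, add_sub_cancel]
    _ = ∫ y, ∫ z, u z * (f (y - z) * g (x - y)) := integral_integral_swap h₂
    _ = _ := by
        congr 1 with y
        rw [← integral_mul_const]
        simp only [mul_assoc]

namespace IsPsiKernel

variable {ψ : ℝ → ℝ × ℝ → ℝ}

lemma integrable (hψ : IsPsiKernel ψ) {T : ℝ} (hT : 0 < T) : Integrable (ψ T) := by
  obtain ⟨φ, hφ⟩ := hψ.1 T hT
  rw [hφ]
  exact φ.integrable

lemma continuous (hψ : IsPsiKernel ψ) {T : ℝ} (hT : 0 < T) : Continuous (ψ T) := by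
  obtain ⟨φ, hφ⟩ := hψ.1 T hT
  rw [hφ]
  exact φ.continuous

/-- Anisotropic self-similarity of the kernel. -/
lemma ae_eq_rescale (hψ : IsPsiKernel ψ) {a : ℝ} (ha : 0 < a) :
    (fun x => ψ (a ^ 4) (a * x.1, a ^ 2 * x.2)) =ᵐ[volume] fun x => (a ^ 3)⁻¹ * ψ 1 x := by
  obtain ⟨C, hC⟩ := hψ.2.1
  have hT : 0 < a ^ 4 := by positivity
  refine ae_eq_of_integral_planeChar_eq
    (integrable_comp_prodMap_mul ha.ne' (pow_pos ha 2).ne' (hψ.integrable hT))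
    ((hψ.integrable one_pos).const_mul _) fun k => ?_
  have h := integral_comp_prodMap_mul ha.ne' (pow_pos ha 2).ne'
    (F := fun x => planeChar (k.1 / a, k.2 / a ^ 2) x * (ψ (a ^ 4) x : ℂ))
    ((continuous_planeChar _).mul (Complex.continuous_ofReal.comp (hψ.continuous hT)))
  have hchar (x : ℝ × ℝ) :
      planeChar (k.1 / a, k.2 / a ^ 2) (a * x.1, a ^ 2 * x.2) = planeChar k x := by
    unfold planeChar
    congr 5
    field_simp
  simp only [hchar] at h
  rw [h]
  have h1 : ∀ x : ℝ × ℝ, planeChar k x * (((a ^ 3)⁻¹ * ψ 1 x : ℝ) : ℂ) =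
      ((a ^ 3)⁻¹ : ℝ) * (planeChar k x * (ψ 1 x : ℂ)) := fun x => by push_cast; ring
  simp only [h1]
  rw [integral_const_mul]
  unfold planeChar
  rw [hC _ hT, hC 1 one_pos, Complex.real_smul, abs_of_pos (by positivity)]
  congr 3
  · field_simp
  · field_simp

lemma integral_abs (hψ : IsPsiKernel ψ) {T : ℝ} (hT : 0 < T) : ∫ x, |ψ T x| = 1 := by
  obtain ⟨a, ha, rfl⟩ : ∃ a : ℝ, 0 < a ∧ a ^ 4 = T :=
    ⟨T ^ (1 / 4 : ℝ), by positivity, by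
      rw [← Real.rpow_natCast, ← Real.rpow_mul hT.le]; norm_num⟩
  have h := integral_comp_prodMap_mul ha.ne' (pow_pos ha 2).ne' (hψ.continuous hT).abs
  have h' : ∫ x : ℝ × ℝ, |ψ (a ^ 4) (a * x.1, a ^ 2 * x.2)| = ∫ x, (a ^ 3)⁻¹ * |ψ 1 x| := by
    refine integral_congr_ae ?_
    filter_upwards [hψ.ae_eq_rescale ha] with x hx
    rw [hx, abs_mul, abs_of_pos (by positivity)]
  rw [h', integral_const_mul, hψ.2.2, abs_of_pos (by positivity), smul_eq_mul] at h
  field_simp at h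
  exact h.symm

/-- The kernels form a convolution semigroup, up to the normalizing constant. -/
lemma exists_semigroup (hψ : IsPsiKernel ψ) :
    ∃ C : ℝ, C ≠ 0 ∧ ∀ s t : ℝ, 0 < s → 0 < t →
      (fun x => ∫ y, ψ s y * ψ t (x - y)) =ᵐ[volume] fun x => C * ψ (s + t) x := by
  obtain ⟨C, hC⟩ := hψ.2.1
  refine ⟨C, ?_, fun s t hs ht => ?_⟩
  · rintro rfl
    have h0 := ae_eq_zero_of_integral_planeChar_eq_zero (hψ.integrable one_pos) fun k => by
      simpa [planeChar] using hC 1 one_pos k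
    have : ∫ x, |ψ 1 x| = 0 := by
      rw [integral_eq_zero_of_ae]
      filter_upwards [h0] with x hx
      simp [hx]
    exact one_ne_zero (hψ.2.2.symm.trans this)
  · refine ae_eq_of_integral_planeChar_eq
      ((hψ.integrable hs).integrable_convolution (ContinuousLinearMap.mul ℝ ℝ) (hψ.integrable ht))
      ((hψ.integrable (add_pos hs ht)).const_mul C) fun k => ?_
    rw [integral_planeChar_convolution (hψ.integrable hs) (hψ.integrable ht)]
    have h1 : ∀ x : ℝ × ℝ, planeChar k x * ((C * ψ (s + t) x : ℝ) : ℂ) =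
        C * (planeChar k x * (ψ (s + t) x : ℂ)) := fun x => by push_cast; ring
    simp only [h1]
    rw [integral_const_mul]
    unfold planeChar
    rw [hC s hs, hC t ht, hC (s + t) (add_pos hs ht), mul_mul_mul_comm, ← Complex.exp_add,
      ← mul_assoc]
    congr 2
    push_cast
    ring

end IsPsiKernel

/-- monotonicity of the `L^∞`-norm in the convolution scale. -/
theorem psi_Linfty_monotonicity
    (ψ : ℝ → ℝ × ℝ → ℝ) (hψ : IsPsiKernel ψ) :
    ∃ C₀ : ℝ, ∀ u : ℝ × ℝ → ℝ, Measurable u → (∃ B : ℝ, ∀ x : ℝ × ℝ, |u x| ≤ B) →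
      ∀ t T : ℝ, 0 < t → t ≤ T →
        ∀ M : ℝ, (∀ y : ℝ × ℝ, |∫ z : ℝ × ℝ, u z * ψ t (y - z)| ≤ M) →
          ∀ x : ℝ × ℝ, |∫ z : ℝ × ℝ, u z * ψ T (x - z)| ≤ C₀ * M := by
  obtain ⟨C, hC0, hC⟩ := hψ.exists_semigroup
  refine ⟨max 1 |C|⁻¹, fun u hu ⟨B, hB⟩ t T ht htT M hM x => ?_⟩
  have hM0 : 0 ≤ M := (abs_nonneg _).trans (hM 0)
  rcases htT.eq_or_lt with rfl | hlt
  · exact (hM x).trans (le_mul_of_one_le_left hM0 (le_max_left _ _))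
  have hs : 0 < T - t := sub_pos.mpr hlt
  have hconv : C * ∫ z, u z * ψ T (x - z) =
      ∫ y, (∫ z, u z * ψ t (y - z)) * ψ (T - t) (x - y) := by
    rw [← integral_convolution_assoc hu hB (hψ.integrable ht) (hψ.integrable hs),
      ← integral_const_mul]
    refine integral_congr_ae ?_
    have hae := hC t (T - t) ht hs
    rw [add_sub_cancel] at hae
    filter_upwards [(quasiMeasurePreserving_sub_left volume x).ae_eq_comp hae] with z hz
    simp only [Function.comp_apply] at hz
    rw [hz]
    ring
  have hbound : |C * ∫ z, u z * ψ T (x - z)| ≤ M := by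
    rw [hconv]
    calc |∫ y, (∫ z, u z * ψ t (y - z)) * ψ (T - t) (x - y)|
        ≤ ∫ y, M * |ψ (T - t) (x - y)| := by
          rw [← Real.norm_eq_abs]
          refine norm_integral_le_of_norm_le
            (((hψ.integrable hs).comp_sub_left x).abs.const_mul M)
            (Filter.Eventually.of_forall fun y => ?_)
          rw [Real.norm_eq_abs, abs_mul]
          exact mul_le_mul_of_nonneg_right (hM y) (abs_nonneg _)
      _ = M := by
          rw [integral_const_mul, integral_sub_left_eq_self (fun y => |ψ (T - t) y|) volume x,
            hψ.integral_abs hs, mul_one]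
  rw [abs_mul] at hbound
  calc |∫ z, u z * ψ T (x - z)| ≤ |C|⁻¹ * M := by
        rwa [inv_mul_eq_div, le_div_iff₀' (abs_pos.mpr hC0)]
    _ ≤ max 1 |C|⁻¹ * M := mul_le_mul_of_nonneg_right (le_max_right _ _) hM0
end
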